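/- arXiv:math/0605474 — 2 statements merged into one kernel-verified Lean document; each statement's English description precedes it below -/
import Mathlib

section
/- For every natural number n and every integer j, the number p_j(5n+4) of partitions of 5n+4 with BG-rank j is divisible by 5. -/
/-- A partition, represented as a weakly decreasing list of positive integers. -/
def IsPartition (l : List ℕ) : Prop :=
  l.Pairwise (· ≥ ·) ∧ ∀ x ∈ l, 0 < x

/-- The BG-rank of a partition `λ₁ ≥ λ₂ ≥ …`:  `Σᵢ (−1)^(i+1) (λᵢ mod 2)`
(with 1-based indexing, i.e. the first part contributes with sign `+1`). -/
def bgRank (l : List ℕ) : ℤ :=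
  ∑ i ∈ Finset.range l.length, (-1 : ℤ) ^ i * ((l.getD i 0 : ℤ) % 2)

/-- `p n`, the number of partitions of `n`. -/
noncomputable def partitionCount (n : ℕ) : ℕ :=
  Nat.card {l : List ℕ // IsPartition l ∧ l.sum = n}

/-- `p_j(n)`, the number of partitions of `n` with BG-rank `j`. -/
noncomputable def pj (j : ℤ) (n : ℕ) : ℕ :=
  Nat.card {l : List ℕ // IsPartition l ∧ l.sum = n ∧ bgRank l = j}

/-- `pp n`, the number of ordered pairs of partitions of total size `n`. -/
noncomputable def pp (n : ℕ) : ℕ :=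
  ∑ k ∈ Finset.range (n + 1), partitionCount k * partitionCount (n - k)

open Finset

/-- q-Pochhammer -/
def poch {A : Type*} [CommRing A] (Q : A) : ℕ → A
  | 0 => 1
  | n + 1 => poch Q n * (1 - Q ^ (n + 1))

/-- theta-type coefficients -/
def cc {A : Type*} [CommRing A] (Q : A) : ℕ → ℕ → A
  | 0, 0 => 1
  | 0, _ + 1 => 0
  | N + 1, 0 => (1 + Q ^ (2 * N + 2)) * cc Q N 0 + Q ^ (N + 1) * (cc Q N 0 + cc Q N 1)
  | N + 1, k + 1 => (1 + Q ^ (2 * N + 2)) * cc Q N (k + 1)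
      + Q ^ (N + 1) * (cc Q N k + cc Q N (k + 2))

/-- triangular numbers -/
def tri : ℕ → ℕ
  | 0 => 0
  | n + 1 => tri n + (n + 1)

theorem two_tri (k : ℕ) : 2 * tri k = k * (k + 1) := by
  induction k with
  | zero => rfl
  | succ k ih => rw [tri, mul_add, ih]; ring

section
variable {A : Type*} [CommRing A] (Q : A)

theorem cc_zero (N k : ℕ) (h : N < k) : cc Q N k = 0 := by
  induction N generalizing k with
  | zero => obtain ⟨k, rfl⟩ : ∃ t, k = t + 1 := ⟨k - 1, by omega⟩; rfl
  | succ N ih =>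
    obtain ⟨k, rfl⟩ : ∃ t, k = t + 1 := ⟨k - 1, by omega⟩
    rw [cc, ih _ (by omega), ih _ (by omega), ih _ (by omega)]; ring

theorem cc_diag (N : ℕ) : cc Q N N = Q ^ tri N := by
  induction N with
  | zero => simp [cc, tri]
  | succ N ih =>
    rw [cc, cc_zero Q N (N + 1) (by omega), cc_zero Q N (N + 2) (by omega), ih, tri, pow_add]
    ring

theorem cc_closed (N : ℕ) : ∀ k d, N = k + d →
    poch Q d * poch Q (2 * k + d + 1) * cc Q N k = Q ^ tri k * poch Q (2 * N + 1) := by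
  induction N with
  | zero =>
    intro k d h
    obtain ⟨rfl, rfl⟩ : k = 0 ∧ d = 0 := by omega
    simp [cc, tri, poch]
  | succ N ih =>
    intro k d h
    rcases d with _ | _ | d
    · obtain rfl : k = N + 1 := by omega
      rw [cc_diag]; simp [poch]; ring
    · obtain rfl : k = N := by omega
      rcases k with _ | k
      · simp [cc, tri, poch]; ring
      · have h1 := ih (k + 1) 0 (by omega)
        have h2 := ih k 1 (by omega)
        rw [cc, cc_zero Q (k + 1) (k + 2) (by omega)]
        have e3 : poch Q (2 * k + 3) = poch Q (2 * k + 2) * (1 - Q ^ (2 * k + 3)) := rfl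
        have e4 : poch Q (2 * k + 4) = poch Q (2 * k + 3) * (1 - Q ^ (2 * k + 4)) := rfl
        have e5 : poch Q (2 * k + 5) = poch Q (2 * k + 4) * (1 - Q ^ (2 * k + 5)) := rfl
        have f0 : poch Q 0 = 1 := rfl
        have f1 : poch Q 1 = 1 - Q := by simp [poch]
        rw [show 2 * (k + 1) + (0 + 1) + 1 = 2 * k + 4 by ring,
          show 2 * (k + 1 + 1) + 1 = 2 * k + 5 by ring, zero_add, tri, e5, e4, e3, f1]
        rw [show 2 * (k + 1) + 0 + 1 = 2 * k + 3 by ring, tri, f0, e3] at h1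
        rw [show 2 * k + 1 + 1 = 2 * k + 2 by ring,
          show 2 * (k + 1) + 1 = 2 * k + 3 by ring, f1, e3] at h2
        clear e3 e4 e5 f0 f1 ih
        generalize poch Q (2 * k + 2) = p at *
        generalize cc Q (k + 1) k = x at *
        generalize cc Q (k + 1) (k + 1) = y at *
        generalize tri k = t at *
        linear_combination (1 + Q ^ (2 * (k + 1) + 2)) * (1 - Q) * (1 - Q ^ (2 * k + 4)) * h1
          + Q ^ (k + 2) * (1 - Q ^ (2 * k + 3)) * (1 - Q ^ (2 * k + 4)) * h2
    · obtain rfl : N = k + d + 1 := by omega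
      rcases k with _ | k
      · have h1 := ih 0 (d + 1) (by omega)
        have h2 := ih 1 d (by omega)
        rw [cc]
        have e1 : poch Q (d + 1) = poch Q d * (1 - Q ^ (d + 1)) := rfl
        have e2 : poch Q (d + 2) = poch Q (d + 1) * (1 - Q ^ (d + 2)) := rfl
        have e3 : poch Q (d + 3) = poch Q (d + 2) * (1 - Q ^ (d + 3)) := rfl
        have g4 : poch Q (2 * d + 4) = poch Q (2 * d + 3) * (1 - Q ^ (2 * d + 4)) := rfl
        have g5 : poch Q (2 * d + 5) = poch Q (2 * d + 4) * (1 - Q ^ (2 * d + 5)) := rfl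
        have t0 : tri 0 = 0 := rfl
        have t1 : tri 1 = 1 := rfl
        rw [show 2 * 0 + (d + 1 + 1) + 1 = d + 3 by ring, show d + 1 + 1 = d + 2 by ring,
          show 2 * (0 + d + 1 + 1) + 1 = 2 * d + 5 by ring,
          show 0 + d + 1 = d + 1 by ring, t0, g5, g4, e3, e2, e1]
        rw [show 2 * 0 + (d + 1) + 1 = d + 2 by ring,
          show 2 * (0 + d + 1) + 1 = 2 * d + 3 by ring,
          show 0 + d + 1 = d + 1 by ring, t0, e2, e1] at h1
        rw [show 2 * 1 + d + 1 = d + 3 by ring,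
          show 2 * (0 + d + 1) + 1 = 2 * d + 3 by ring,
          show 0 + d + 1 = d + 1 by ring, t1, e3, e2, e1] at h2
        clear e1 e2 e3 g4 g5 t0 t1 ih
        generalize poch Q (2 * d + 3) = p at *
        generalize poch Q d = r at *
        generalize cc Q (d + 1) 0 = x at *
        generalize cc Q (d + 1) 1 = y at *
        linear_combination (1 + Q ^ (2 * (d + 1) + 2) + Q ^ (d + 2)) * (1 - Q ^ (d + 2)) * (1 - Q ^ (d + 3)) * h1
          + Q ^ (d + 2) * (1 - Q ^ (d + 1)) * (1 - Q ^ (d + 2)) * h2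
      · have h1 := ih (k + 1) (d + 1) (by omega)
        have h2 := ih k (d + 2) (by omega)
        have h3 := ih (k + 2) d (by omega)
        rw [cc]
        have e1 : poch Q (d + 1) = poch Q d * (1 - Q ^ (d + 1)) := rfl
        have e2 : poch Q (d + 2) = poch Q (d + 1) * (1 - Q ^ (d + 2)) := rfl
        have f4 : poch Q (2 * k + d + 4) = poch Q (2 * k + d + 3) * (1 - Q ^ (2 * k + d + 4)) := rfl
        have f5 : poch Q (2 * k + d + 5) = poch Q (2 * k + d + 4) * (1 - Q ^ (2 * k + d + 5)) := rfl
        have g6 : poch Q (2 * k + 2 * d + 6)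
          = poch Q (2 * k + 2 * d + 5) * (1 - Q ^ (2 * k + 2 * d + 6)) := rfl
        have g7 : poch Q (2 * k + 2 * d + 7)
          = poch Q (2 * k + 2 * d + 6) * (1 - Q ^ (2 * k + 2 * d + 7)) := rfl
        have t1 : tri (k + 1) = tri k + (k + 1) := rfl
        have t2 : tri (k + 2) = tri (k + 1) + (k + 2) := rfl
        rw [show 2 * (k + 1) + (d + 1 + 1) + 1 = 2 * k + d + 5 by ring,
          show 2 * (k + 1 + d + 1 + 1) + 1 = 2 * k + 2 * d + 7 by ring,
          show d + 1 + 1 = d + 2 by ring, t1, g7, g6, f5, f4, e2, e1]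
        rw [show 2 * (k + 1) + (d + 1) + 1 = 2 * k + d + 4 by ring,
          show 2 * (k + 1 + d + 1) + 1 = 2 * k + 2 * d + 5 by ring, t1, f4, e1] at h1
        rw [show 2 * k + (d + 2) + 1 = 2 * k + d + 3 by ring,
          show 2 * (k + 1 + d + 1) + 1 = 2 * k + 2 * d + 5 by ring, e2, e1] at h2
        rw [show 2 * (k + 2) + d + 1 = 2 * k + d + 5 by ring,
          show 2 * (k + 1 + d + 1) + 1 = 2 * k + 2 * d + 5 by ring, t2, t1, f5, f4] at h3
        clear e1 e2 f4 f5 g6 g7 t1 t2 ih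
        generalize poch Q (2 * k + 2 * d + 5) = p at *
        generalize poch Q (2 * k + d + 3) = s at *
        generalize poch Q d = r at *
        generalize cc Q (k + 1 + d + 1) k = x at *
        generalize cc Q (k + 1 + d + 1) (k + 1) = y at *
        generalize cc Q (k + 1 + d + 1) (k + 2) = z at *
        generalize tri k = t at *
        linear_combination (1 + Q ^ (2 * (k + 1 + d + 1) + 2)) * (1 - Q ^ (d + 2)) * (1 - Q ^ (2 * k + d + 5)) * h1
          + Q ^ (k + d + 3) * (1 - Q ^ (2 * k + d + 4)) * (1 - Q ^ (2 * k + d + 5)) * h2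
          + Q ^ (k + d + 3) * (1 - Q ^ (d + 1)) * (1 - Q ^ (d + 2)) * h3

theorem cc_sum (N : ℕ) : ∀ L, N < L →
    ∑ k ∈ range L, (-1 : A) ^ k * (2 * k + 1) * cc Q N k = poch Q N ^ 2 := by
  induction N with
  | zero =>
    intro L hL
    obtain ⟨L, rfl⟩ : ∃ t, L = t + 1 := ⟨L - 1, by omega⟩
    rw [sum_range_succ']
    simp [cc, poch]
  | succ N ih =>
    intro L hL
    obtain ⟨L, rfl⟩ : ∃ t, L = t + 2 := ⟨L - 2, by omega⟩
    have key : ∀ L, ∑ k ∈ range (L + 1), (-1 : A) ^ k * (2 * k + 1) * cc Q (N + 1) k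
      = (1 - Q ^ (N + 1)) ^ 2 * ∑ k ∈ range (L + 1), (-1 : A) ^ k * (2 * k + 1) * cc Q N k
        + Q ^ (N + 1) * ((-1 : A) ^ L * (2 * L + 3) * cc Q N L
           + (-1 : A) ^ L * (2 * L + 1) * cc Q N (L + 1)) := by
      intro L
      induction L with
      | zero => simp [cc]; ring
      | succ L ihL =>
        rw [sum_range_succ, ihL, sum_range_succ _ (L + 1), cc]
        push_cast
        ring
    rw [key, ih _ (by omega), cc_zero Q N _ (by omega), cc_zero Q N _ (by omega), poch]
    ring

theorem poch_stable (K : ℕ) (hQ : Q ^ (K + 1) = 0) (N : ℕ) (h : K ≤ N) :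
    poch Q N = poch Q K := by
  induction N, h using Nat.le_induction with
  | base => rfl
  | succ n hn ih =>
    rw [poch, ih, pow_eq_zero_of_le (by omega) hQ]; ring

theorem poch_unit (hQ : IsNilpotent Q) (N : ℕ) : IsUnit (poch Q N) := by
  induction N with
  | zero => simp [poch]
  | succ n ih =>
    rw [poch]
    exact ih.mul (IsNilpotent.isUnit_one_sub (hQ.pow_succ n))

theorem poch_absorb (w : A) (d r : ℕ) (h : ∀ i, d < i → w * Q ^ i = 0) :
    w * poch Q (d + r) = w * poch Q d := by
  induction r with
  | zero => rfl
  | succ r ih =>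
    rw [← add_assoc, poch]
    linear_combination ih - poch Q (d + r) * h (d + r + 1) (by omega)

theorem jacobi (N : ℕ) (hQ : Q ^ (N + 1) = 0) :
    poch Q N ^ 3 = ∑ k ∈ range (N + 1), (-1 : A) ^ k * (2 * k + 1) * Q ^ tri k := by
  rw [pow_succ, ← cc_sum Q N (N + 1) (by omega), sum_mul]
  refine sum_congr rfl fun k hk => ?_
  rw [mem_range] at hk
  obtain ⟨d, rfl⟩ : ∃ d, N = k + d := ⟨N - k, by omega⟩
  have h := cc_closed Q (k + d) k d rfl
  rw [poch_stable Q (k + d) hQ (2 * k + d + 1) (by omega), poch_stable Q (k + d) hQ (2 * (k + d) + 1) (by omega)] at h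
  have hu := poch_unit Q ⟨_, hQ⟩ (k + d)
  have h1 : cc Q (k + d) k * poch Q d = Q ^ tri k := by
    apply hu.mul_right_cancel
    linear_combination h
  have hz : ∀ i, d < i → Q ^ tri k * Q ^ i = 0 := by
    intro i hi
    rw [← pow_add]
    refine pow_eq_zero_of_le ?_ hQ
    have : k ≤ tri k := by cases k <;> simp [tri]
    omega
  have h2 := poch_absorb Q (cc Q (k + d) k * poch Q d) d k (by rw [h1]; exact hz)
  have hud := poch_unit Q ⟨_, hQ⟩ d
  have h3 : cc Q (k + d) k * poch Q (d + k) = Q ^ tri k := by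
    rw [← h1]; apply hud.mul_right_cancel; linear_combination h2
  rw [add_comm d k] at h3
  rw [mul_assoc, h3]

end

/-! ### counting -/

theorem bgRank_cons (a : ℕ) (l : List ℕ) : bgRank (a :: l) = (a : ℤ) % 2 - bgRank l := by
  unfold bgRank
  rw [List.length_cons, sum_range_succ']
  simp [pow_succ]
  ring

/-- the partitions with bounded parts -/
def SS (m : ℕ) (j : ℤ) (n : ℕ) : Set (List ℕ) :=
  {l | IsPartition l ∧ (∀ x ∈ l, x ≤ m) ∧ l.sum = n ∧ bgRank l = j}

theorem isPartition_cons (a : ℕ) (l : List ℕ) :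
    IsPartition (a :: l) ↔ 0 < a ∧ (∀ x ∈ l, x ≤ a) ∧ IsPartition l := by
  simp only [IsPartition, List.pairwise_cons, List.mem_cons, forall_eq_or_imp]
  tauto

theorem SS_zero (j : ℤ) (n : ℕ) : SS 0 j n = if j = 0 ∧ n = 0 then {[]} else ∅ := by
  ext l
  rcases l with _ | ⟨a, l⟩
  · split_ifs with h
    · simp [SS, h, IsPartition, bgRank]
    · simp [SS, IsPartition, bgRank]; tauto
  · have : (a :: l) ∉ SS 0 j n := by
      rintro ⟨h1, h2, -⟩
      rw [isPartition_cons] at h1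
      have := h2 a (by simp)
      omega
    split_ifs <;> simp [this]

theorem SS_succ (m : ℕ) (j : ℤ) (n : ℕ) : SS (m + 1) j n = SS m j n ∪
    if m + 1 ≤ n then List.cons (m + 1) '' SS (m + 1) (((m + 1 : ℕ) : ℤ) % 2 - j) (n - (m + 1))
      else ∅ := by
  ext l
  constructor
  · rintro ⟨h1, h2, h3, h4⟩
    rcases l with _ | ⟨a, l⟩
    · left; exact ⟨h1, by simp, h3, h4⟩
    · rw [isPartition_cons] at h1
      rw [bgRank_cons] at h4
      rw [List.sum_cons] at h3
      have ha := h2 a (by simp)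
      rcases Nat.lt_or_ge m a with h | h
      · obtain rfl : a = m + 1 := by omega
        right
        rw [if_pos (by omega)]
        exact ⟨l, ⟨h1.2.2, h1.2.1, by omega, by omega⟩, rfl⟩
      · left
        refine ⟨(isPartition_cons _ _).2 h1, ?_, by simpa using h3, by rw [bgRank_cons]; exact h4⟩
        intro x hx
        rcases List.mem_cons.1 hx with rfl | hx
        · exact h
        · exact (h1.2.1 x hx).trans h
  · rintro (⟨h1, h2, h3, h4⟩ | h)
    · exact ⟨h1, fun x hx => (h2 x hx).trans (by omega), h3, h4⟩
    · split_ifs at h with hn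
      · obtain ⟨l, ⟨h1, h2, h3, h4⟩, rfl⟩ := h
        refine ⟨(isPartition_cons _ _).2 ⟨by omega, h2, h1⟩, ?_, ?_, ?_⟩
        · intro x hx
          rcases List.mem_cons.1 hx with rfl | hx
          · exact le_rfl
          · exact h2 x hx
        · rw [List.sum_cons]; omega
        · rw [bgRank_cons]; omega
      · exact absurd h (by simp)

theorem SS_finite (m : ℕ) : ∀ j n, (SS m j n).Finite := by
  induction m with
  | zero => intro j n; rw [SS_zero]; split_ifs <;> simp
  | succ m ih =>
    intro j n
    induction n using Nat.strong_induction_on generalizing j with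
    | _ n ihn =>
      rw [SS_succ]
      refine (ih j n).union ?_
      split_ifs with h
      · exact (ihn _ (by omega) _).image _
      · exact Set.finite_empty

theorem SS_card (m : ℕ) (j : ℤ) (n : ℕ) : (SS (m + 1) j n).ncard = (SS m j n).ncard +
    if m + 1 ≤ n then (SS (m + 1) (((m + 1 : ℕ) : ℤ) % 2 - j) (n - (m + 1))).ncard else 0 := by
  conv_lhs => rw [SS_succ]
  split_ifs with h
  · rw [Set.ncard_union_eq _ (SS_finite _ _ _) ((SS_finite _ _ _).image _),
      Set.ncard_image_of_injective _ (List.cons_injective)]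
    rw [Set.disjoint_left]
    rintro _ h1 ⟨l, -, rfl⟩
    have := h1.2.1 (m + 1) (by simp)
    omega
  · simp

theorem pj_eq (j : ℤ) (n m : ℕ) (h : n ≤ m) : pj j n = (SS m j n).ncard := by
  rw [pj, ← Nat.card_coe_set_eq]
  congr 2
  ext l
  constructor
  · rintro ⟨h1, h2, h3⟩
    exact ⟨h1, fun x hx => (List.le_sum_of_mem hx).trans (by omega), h2, h3⟩
  · rintro ⟨h1, -, h2, h3⟩
    exact ⟨h1, h2, h3⟩

open PowerSeries in
/-- generating function -/
noncomputable def ff (m : ℕ) (j : ℤ) : PowerSeries (ZMod 5) :=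
  PowerSeries.mk fun n => ((SS m j n).ncard : ZMod 5)

section
open PowerSeries

instance fact5 : Fact (Nat.Prime 5) := ⟨by norm_num⟩

local notation "q" => (X : PowerSeries (ZMod 5))

theorem ff_zero (j : ℤ) : ff 0 j = if j = 0 then 1 else 0 := by
  ext n
  rw [ff, coeff_mk, SS_zero]
  by_cases hj : j = 0 <;> by_cases hn : n = 0 <;> simp [hj, hn, coeff_one]

theorem ff_succ (m : ℕ) (j : ℤ) :
    ff (m + 1) j = ff m j + q ^ (m + 1) * ff (m + 1) (((m + 1 : ℕ) : ℤ) % 2 - j) := by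
  ext n
  rw [map_add, coeff_X_pow_mul']
  simp only [ff, coeff_mk]
  rw [SS_card]
  split_ifs <;> push_cast <;> simp

theorem ff_rec (m : ℕ) (j : ℤ) :
    (1 - (q ^ 2) ^ (m + 1)) * ff (m + 1) j
      = ff m j + q ^ (m + 1) * ff m (((m + 1 : ℕ) : ℤ) % 2 - j) := by
  have h1 := ff_succ m j
  have h2 := ff_succ m (((m + 1 : ℕ) : ℤ) % 2 - j)
  rw [sub_sub_cancel] at h2
  rw [← pow_mul, mul_comm 2, pow_mul]
  linear_combination h1 + q ^ (m + 1) * h2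

theorem one_sub_ne (m : ℕ) : (1 - (q ^ 2) ^ (m + 1)) ≠ 0 := by
  intro h
  have := congrArg (constantCoeff (R := ZMod 5)) h
  simp at this

/-- exponent -/
def Jn (j : ℤ) : ℕ := (j * (2 * j - 1)).toNat

theorem Jn_cast (j : ℤ) : (Jn j : ℤ) = j * (2 * j - 1) := by
  apply Int.toNat_of_nonneg
  rcases le_or_gt j 0 with h | h
  · nlinarith
  · apply mul_nonneg <;> omega

theorem ff_step (m a b : ℕ) (J J' : ℕ) (F G H : PowerSeries (ZMod 5)) (hab : a + b = m + 1)
    (hr : (1 - (q ^ 2) ^ (m + 1)) * F = G + q ^ (m + 1) * H)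
    (hJ : J' + (m + 1) = J + 2 * b)
    (hG0 : b = 0 → G = 0) (hH0 : a = 0 → H = 0)
    (hG : ∀ b', b = b' + 1 → G * poch (q ^ 2) a * poch (q ^ 2) b' = q ^ J)
    (hH : ∀ a', a = a' + 1 → H * poch (q ^ 2) b * poch (q ^ 2) a' = q ^ J') :
    F * poch (q ^ 2) a * poch (q ^ 2) b = q ^ J := by
  have h1 : G * poch (q ^ 2) a * poch (q ^ 2) b = q ^ J * (1 - (q ^ 2) ^ b) := by
    rcases b with _ | b
    · simp [hG0 rfl]
    · rw [poch, ← hG b rfl]; ring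
  have h2 : H * poch (q ^ 2) a * poch (q ^ 2) b = q ^ J' * (1 - (q ^ 2) ^ a) := by
    rcases a with _ | a
    · simp [hH0 rfl]
    · rw [poch, ← hH a rfl]; ring
  apply mul_left_cancel₀ (one_sub_ne m)
  have h3 : q ^ J' * q ^ (m + 1) = q ^ J * (q ^ 2) ^ b := by
    rw [← pow_add, hJ, pow_add, pow_mul]
  have h4 : (q ^ 2) ^ (m + 1) = (q ^ 2) ^ a * (q ^ 2) ^ b := by rw [← pow_add, hab]
  linear_combination poch (q ^ 2) a * poch (q ^ 2) b * hr + h1 + q ^ (m + 1) * h2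
    + (1 - (q ^ 2) ^ a) * h3 + q ^ J * h4

theorem ff_closed (m : ℕ) : ∀ j : ℤ,
    (((m : ℤ) / 2 + j < 0 ∨ ((m : ℤ) + 1) / 2 - j < 0) → ff m j = 0) ∧
    ∀ a b : ℕ, (a : ℤ) = (m : ℤ) / 2 + j → (b : ℤ) = ((m : ℤ) + 1) / 2 - j →
      ff m j * poch (q ^ 2) a * poch (q ^ 2) b = q ^ Jn j := by
  induction m with
  | zero =>
    intro j
    constructor
    · intro h
      rw [ff_zero, if_neg (by omega)]
    · intro a b ha hb
      obtain rfl : j = 0 := by omega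
      obtain rfl : a = 0 := by omega
      obtain rfl : b = 0 := by omega
      simp [ff_zero, poch, Jn]
  | succ m ih =>
    intro j
    have hr := ff_rec m j
    set s := ((m + 1 : ℕ) : ℤ) % 2 - j with hs
    have hjJ := Jn_cast j
    have hsJ := Jn_cast s
    constructor
    · intro h
      apply (mul_eq_zero.1 _).resolve_left (one_sub_ne m)
      rw [hr, (ih j).1 (by omega), (ih s).1 (by omega)]; ring
    · intro a b ha hb
      rcases Nat.even_or_odd' m with ⟨t, rfl | rfl⟩
      · have hs' : s = 1 - j := by omega
        rw [hs'] at hr hsJ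
        refine ff_step (2 * t) a b (Jn j) (Jn (1 - j)) _ _ _ (by omega) hr ?_ ?_ ?_ ?_ ?_
        · zify
          rw [hjJ, hsJ]
          have : (b : ℤ) = t + 1 - j := by omega
          rw [this]; push_cast; ring
        · intro h; exact (ih j).1 (by omega)
        · intro h; exact (ih (1 - j)).1 (by omega)
        · intro b' h; exact (ih j).2 _ _ (by omega) (by omega)
        · intro a' h; exact (ih (1 - j)).2 _ _ (by omega) (by omega)
      · have hs' : s = - j := by omega
        rw [hs'] at hr hsJ
        rw [mul_right_comm]
        refine ff_step (2 * t + 1) b a (Jn j) (Jn (-j)) _ _ _ (by omega) hr ?_ ?_ ?_ ?_ ?_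
        · zify
          rw [hjJ, hsJ]
          have : (a : ℤ) = t + 1 + j := by omega
          rw [this]; push_cast; ring
        · intro h; exact (ih j).1 (by omega)
        · intro h; exact (ih (-j)).1 (by omega)
        · intro b' h
          rw [mul_right_comm]
          exact (ih j).2 _ _ (by omega) (by omega)
        · intro a' h
          rw [mul_right_comm]
          exact (ih (-j)).2 _ _ (by omega) (by omega)

theorem poch_five (M : ℕ) : constantCoeff (poch (q ^ 2) M ^ 5) = 1 ∧
    ∀ i, ¬ 5 ∣ i → coeff i (poch (q ^ 2) M ^ 5) = 0 := by
  have : CharP (PowerSeries (ZMod 5)) 5 := charP_of_injective_algebraMap (R := ZMod 5) (algebraMap (ZMod 5) (PowerSeries (ZMod 5))).injective 5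
  induction M with
  | zero =>
    refine ⟨by simp [poch], fun i hi => ?_⟩
    have : i ≠ 0 := by rintro rfl; simp at hi
    simp [poch, coeff_one, this]
  | succ M ih =>
    have h5 : (1 - (q ^ 2) ^ (M + 1)) ^ 5 = 1 - q ^ (5 * (2 * (M + 1))) := by
      rw [sub_pow_char (p := 5)]
      ring
    rw [poch, mul_pow, h5]
    refine ⟨by rw [map_mul, ih.1]; simp, fun i hi => ?_⟩
    rw [mul_sub, mul_one, map_sub, ih.2 i hi, coeff_mul_X_pow']
    split_ifs with h
    · rw [ih.2 _ (by omega)]; simp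
    · simp

theorem extract (F U : PowerSeries (ZMod 5)) (n : ℕ) (hU0 : constantCoeff U = 1)
    (hU : ∀ i, ¬ 5 ∣ i → coeff i U = 0)
    (hFU : ∀ i ≤ n, i % 5 = 4 → coeff i (F * U) = 0) :
    ∀ i ≤ n, i % 5 = 4 → coeff i F = 0 := by
  intro i
  induction i using Nat.strong_induction_on with
  | _ i ih =>
    intro hi h4
    have h := hFU i hi h4
    rw [coeff_mul, sum_eq_single (i, 0)] at h
    · simpa [hU0] using h
    · rintro ⟨x, y⟩ hxy hne
      rw [HasAntidiagonal.mem_antidiagonal] at hxy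
      simp only at hxy ⊢
      have hy : y ≠ 0 := by
        rintro rfl
        apply hne; simp; omega
      by_cases h5 : 5 ∣ y
      · rw [ih x (by omega) (by omega) (by omega), zero_mul]
      · rw [hU y h5, mul_zero]
    · intro h; exact absurd (by simp) h

theorem poch_map {A B : Type*} [CommRing A] [CommRing B] (φ : A →+* B) (Q : A) (N : ℕ) :
    φ (poch Q N) = poch (φ Q) N := by
  induction N with
  | zero => simp [poch]
  | succ N ih => simp [poch, ih]

theorem residue (j : ℤ) (k i : ℕ) (h4 : i % 5 = 4) (h : i = Jn j + 2 * tri k) :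
    (2 * (k : ZMod 5) + 1) = 0 := by
  have hc : ((i : ℤ) : ZMod 5) = 4 := by
    have : (i : ℤ) = 5 * ((i / 5 : ℕ) : ℤ) + 4 := by omega
    rw [this]; push_cast
    rw [show (5 : ZMod 5) = 0 from rfl]; ring
  have h2 : (i : ℤ) = j * (2 * j - 1) + k * (k + 1) := by
    rw [h, two_tri]; push_cast; rw [Jn_cast]
  rw [h2] at hc
  push_cast at hc
  generalize (j : ZMod 5) = x at hc
  generalize (k : ZMod 5) = y at hc ⊢
  revert x y
  decide

theorem main_aux (j : ℤ) (n M : ℕ) (hM : n + j.natAbs ≤ M) :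
    ∀ i ≤ n, i % 5 = 4 → coeff i (ff (2 * M) j) = 0 := by
  refine extract _ (poch (q ^ 2) n ^ 5) n (poch_five n).1 (poch_five n).2 ?_
  intro i hi h4
  set S := ∑ k ∈ range (n + 1), (-1 : PowerSeries (ZMod 5)) ^ k * (2 * k + 1) * (q ^ 2) ^ tri k
    with hS
  have hdvd : q ^ (n + 1) ∣ ff (2 * M) j * poch (q ^ 2) n ^ 5 - q ^ Jn j * S := by
    rw [← Ideal.mem_span_singleton, ← Ideal.Quotient.eq]
    set φ := Ideal.Quotient.mk (Ideal.span {q ^ (n + 1)}) with hφ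
    have hq : φ q ^ (n + 1) = 0 := by
      rw [← map_pow, hφ, Ideal.Quotient.eq_zero_iff_mem]
      exact Ideal.mem_span_singleton_self _
    have hQ : (φ q ^ 2) ^ (n + 1) = 0 := by
      rw [← pow_mul, mul_comm, pow_mul, hq]; simp
    have hc := (ff_closed (2 * M) j).2 ((M : ℤ) + j).toNat ((M : ℤ) - j).toNat
      (by omega) (by omega)
    have hc' := congrArg φ hc
    simp only [map_mul, poch_map, map_pow] at hc'
    rw [poch_stable _ n hQ ((M : ℤ) + j).toNat (by omega),
      poch_stable _ n hQ ((M : ℤ) - j).toNat (by omega)] at hc'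
    have hj := jacobi (φ q ^ 2) n hQ
    simp only [hS, map_mul, map_pow, poch_map, map_sum, map_add, map_neg, map_one, map_natCast,
      map_ofNat]
    rw [← hj, ← hc']
    ring
  have h0 : coeff i (ff (2 * M) j * poch (q ^ 2) n ^ 5) = coeff i (q ^ Jn j * S) := by
    rw [← sub_eq_zero, ← map_sub]
    exact X_pow_dvd_iff.1 hdvd i (by omega)
  rw [h0, hS, mul_sum, map_sum]
  refine sum_eq_zero fun k _ => ?_
  have : q ^ Jn j * ((-1) ^ k * (2 * (k : PowerSeries (ZMod 5)) + 1) * (q ^ 2) ^ tri k)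
      = C ((-1) ^ k * (2 * (k : ZMod 5) + 1)) * q ^ (Jn j + 2 * tri k) := by
    simp only [map_mul, map_pow, map_add, map_neg, map_one, map_natCast, map_ofNat]
    rw [pow_add, pow_mul]; ring
  rw [this, coeff_C_mul, coeff_X_pow]
  split_ifs with h
  · rw [residue j k i h4 h]; simp
  · simp

end

theorem pj_five_mul_add_four_cong (n : ℕ) (j : ℤ) :
    (5 : ℕ) ∣ pj j (5 * n + 4) := by
  rw [← ZMod.natCast_eq_zero_iff, pj_eq j (5 * n + 4) (2 * (5 * n + 4 + j.natAbs)) (by omega)]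
  have := main_aux j (5 * n + 4) _ le_rfl (5 * n + 4) le_rfl (by omega)
  rwa [ff, PowerSeries.coeff_mk] at this
end

section
/- For every natural number n with n ≡ 2, 3, or 4 (mod 5), the number pp(n) of ordered pairs of partitions of total size n is divisible by 5. -/
open PowerSeries in
noncomputable def ppE : PowerSeries (ZMod 5) := pentagonalSeries (ZMod 5)

open PowerSeries in
noncomputable def ppEr (r : ℕ) : PowerSeries (ZMod 5) :=
  PowerSeries.mk fun n => if n % 5 = r then coeff n ppE else 0

noncomputable def ppT (N : ℕ) : Finset (ℤ × ℤ) :=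
  ((Finset.Icc (-(N : ℤ)) N) ×ˢ (Finset.Icc (-(N : ℤ)) N)).filter
    fun x => pentagonal x.1 + pentagonal x.2 = N

lemma abs_le_pent (m : ℤ) : |m| ≤ pentagonal m := by
  have h := two_mul_natCast_pentagonal m
  rcases abs_cases m with ⟨h1, h2⟩ | ⟨h1, h2⟩
  · rw [h1]
    rcases eq_or_lt_of_le h2 with h3 | h3
    · omega
    · nlinarith
  · rw [h1]; nlinarith

lemma mem_ppT (N : ℕ) (x : ℤ × ℤ) : x ∈ ppT N ↔ pentagonal x.1 + pentagonal x.2 = N := by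
  have h1 := abs_le_pent x.1
  have h2 := abs_le_pent x.2
  rw [abs_le] at h1 h2
  simp only [ppT, Finset.mem_filter, Finset.mem_product, Finset.mem_Icc]
  constructor
  · exact fun h => h.2
  · intro h; exact ⟨by omega, h⟩

def ppS (m : ℤ) : ZMod 5 := ((Int.negOnePow m : ℤˣ) : ℤ)

open PowerSeries in
lemma pp_sum (N : ℕ) (W : ℕ → ℕ → ZMod 5) :
    ∑ p ∈ Finset.HasAntidiagonal.antidiagonal N, coeff p.1 ppE * coeff p.2 ppE * W p.1 p.2 =
    ∑ x ∈ ppT N, ppS x.1 * ppS x.2 * W (pentagonal x.1) (pentagonal x.2) := by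
  symm
  refine Finset.sum_of_injOn (fun x => (pentagonal x.1, pentagonal x.2)) ?_ ?_ ?_ ?_
  · rintro ⟨a, b⟩ _ ⟨c, d⟩ _ h
    simpa using h
  · intro x hx
    have := (mem_ppT N x).1 hx
    simpa using this
  · rintro ⟨a, b⟩ hab hn
    simp only [Finset.HasAntidiagonal.mem_antidiagonal] at hab
    by_cases ha : a ∈ Set.range pentagonal
    · by_cases hb : b ∈ Set.range pentagonal
      · obtain ⟨m, rfl⟩ := ha
        obtain ⟨n, rfl⟩ := hb
        exact absurd ⟨(m, n), (mem_ppT N (m, n)).2 hab, rfl⟩ hn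
      · simp [ppE, coeff_pentagonalSeries_eq_zero _ hb]
    · simp [ppE, coeff_pentagonalSeries_eq_zero _ ha]
  · intro x _
    simp [ppE, ppS]

def ppU (m n : ℤ) : ZMod 5 := if (m + 3 * n) % 5 = 4 then 1 else 0

def ppW (a b : ℕ) : ZMod 5 :=
  (if a % 5 = 0 ∧ b % 5 = 2 then 1 else 0) + (if a % 5 = 1 ∧ b % 5 = 1 then 1 else 0)

lemma ppS_sq (m n : ℤ) (h : (m - n) % 2 = 1) : ppS m + ppS n = 0 := by
  have : m = n + (m - n) := by ring
  rw [this, ppS, ppS, Int.negOnePow_add, Int.negOnePow_odd (m - n) (Int.odd_iff.2 h)]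
  simp

lemma ppS_mul (m n : ℤ) : ppS m * ppS n = ppS (m + n) := by
  simp [ppS, Int.negOnePow_add]

lemma sumU (N : ℕ) : ∑ x ∈ ppT N, ppS x.1 * ppS x.2 * ppU x.1 x.2 = 0 := by
  have : ∀ x : ℤ × ℤ, ppS x.1 * ppS x.2 * ppU x.1 x.2 =
      if (x.1 + 3 * x.2) % 5 = 4 then ppS (x.1 + x.2) else 0 := by
    intro x; rw [ppU, ppS_mul]; split_ifs <;> simp
  simp_rw [this]
  rw [← Finset.sum_filter]
  refine Finset.sum_involution
    (fun x _ => ((2 - 3 * x.1 - 4 * x.2) / 5, (3 * x.2 - 4 * x.1 + 1) / 5)) ?_ ?_ ?_ ?_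
  · rintro ⟨m, n⟩ h
    simp only [Finset.mem_filter] at h
    apply ppS_sq
    dsimp only
    omega
  · rintro ⟨m, n⟩ h _ h2
    simp only [Finset.mem_filter, Prod.mk.injEq] at h h2
    omega
  · rintro ⟨m, n⟩ h
    simp only [Finset.mem_filter, mem_ppT] at h ⊢
    obtain ⟨h1, h2⟩ := h
    obtain ⟨m', hm⟩ : ∃ m', m' = (2 - 3 * m - 4 * n) / 5 := ⟨_, rfl⟩
    obtain ⟨n', hn⟩ : ∃ n', n' = (3 * n - 4 * m + 1) / 5 := ⟨_, rfl⟩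
    rw [← hm, ← hn]
    have hm1 : m = (2 - 3 * m' - 4 * n') / 5 := by omega
    have e1 : m = 2 - 3 * m' - 4 * n' - 4 * m := by omega
    have e2 : 5 * n = 3 * n' - 4 * m' + 1 := by omega
    have e1 : 5 * m = 2 - 3 * m' - 4 * n' := by omega
    refine ⟨?_, by omega⟩
    have a1 := two_mul_natCast_pentagonal m
    have a2 := two_mul_natCast_pentagonal n
    have a3 := two_mul_natCast_pentagonal m'
    have a4 := two_mul_natCast_pentagonal n'
    have f1 : 5 * m' = 2 - 3 * m - 4 * n := by omega
    have f2 : 5 * n' = 3 * n - 4 * m + 1 := by omega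
    have key : 25 * (m' * (3 * m' - 1) + n' * (3 * n' - 1)) =
        25 * (m * (3 * m - 1) + n * (3 * n - 1)) := by
      have : 25 * (m' * (3 * m' - 1) + n' * (3 * n' - 1)) =
        (5 * m') * (3 * (5 * m') - 5) + (5 * n') * (3 * (5 * n') - 5) := by ring
      rw [this, f1, f2]; ring
    zify at h1 ⊢
    linarith
  · rintro ⟨m, n⟩ h
    simp only [Finset.mem_filter] at h
    simp only [Prod.mk.injEq]
    omega

lemma sum_swap (N : ℕ) (f : ℤ → ℤ → ZMod 5) :
    ∑ x ∈ ppT N, ppS x.1 * ppS x.2 * f x.2 x.1 = ∑ x ∈ ppT N, ppS x.1 * ppS x.2 * f x.1 x.2 := by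
  refine Finset.sum_nbij' (fun x => (x.2, x.1)) (fun x => (x.2, x.1)) ?_ ?_ ?_ ?_ ?_
  · intro x hx; simp only [mem_ppT] at *; omega
  · intro x hx; simp only [mem_ppT] at *; omega
  · intro x _; rfl
  · intro x _; rfl
  · intro x _; dsimp only; ring

lemma pent_mod (m : ℤ) : (m % 5 = 0 ∧ pentagonal m % 5 = 0) ∨ (m % 5 = 1 ∧ pentagonal m % 5 = 1) ∨
    (m % 5 = 2 ∧ pentagonal m % 5 = 0) ∨ (m % 5 = 3 ∧ pentagonal m % 5 = 2) ∨
    (m % 5 = 4 ∧ pentagonal m % 5 = 2) := by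
  have h := two_mul_natCast_pentagonal m
  obtain ⟨q, r, hr, hm⟩ : ∃ q r : ℤ, (r = 0 ∨ r = 1 ∨ r = 2 ∨ r = 3 ∨ r = 4) ∧ m = 5 * q + r :=
    ⟨m / 5, m % 5, by omega, by omega⟩
  have h' : 2 * (pentagonal m : ℤ) = 5 * (15 * (q * q) + 6 * q * r - q) + r * (3 * r - 1) := by
    rw [h, hm]; ring
  rcases hr with rfl | rfl | rfl | rfl | rfl <;> omega

lemma pointwise (m n : ℤ) : ppW (pentagonal m) (pentagonal n) + ppW (pentagonal n) (pentagonal m)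
    = ppU m n + ppU n m := by
  unfold ppW ppU
  have e1 : (m + 3 * n) % 5 = (m % 5 + 3 * (n % 5)) % 5 := by omega
  have e2 : (n + 3 * m) % 5 = (n % 5 + 3 * (m % 5)) % 5 := by omega
  rw [e1, e2]
  rcases pent_mod m with h | h | h | h | h <;> rcases pent_mod n with h' | h' | h' | h' | h' <;>
    rw [h.1, h.2, h'.1, h'.2] <;> decide

lemma sumW (N : ℕ) : ∑ x ∈ ppT N, ppS x.1 * ppS x.2 * ppW (pentagonal x.1) (pentagonal x.2) = 0 := by
  have h1 := sum_swap N (fun m n => ppW (pentagonal m) (pentagonal n))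
  have h2 := sum_swap N ppU
  have h3 := sumU N
  have h4 : ∑ x ∈ ppT N, ppS x.1 * ppS x.2 * ppW (pentagonal x.1) (pentagonal x.2) +
      ∑ x ∈ ppT N, ppS x.1 * ppS x.2 * ppW (pentagonal x.2) (pentagonal x.1) = 
      ∑ x ∈ ppT N, ppS x.1 * ppS x.2 * ppU x.1 x.2 +
      ∑ x ∈ ppT N, ppS x.1 * ppS x.2 * ppU x.2 x.1 := by
    rw [← Finset.sum_add_distrib, ← Finset.sum_add_distrib]
    refine Finset.sum_congr rfl fun x _ => ?_
    rw [← mul_add, ← mul_add, pointwise]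

  rw [h1, h2, h3] at h4
  generalize ∑ x ∈ ppT N, ppS x.1 * ppS x.2 * ppW (pentagonal x.1) (pentagonal x.2) = y at h4
  revert h4; revert y; decide

open PowerSeries in
lemma ppE_rel : ppEr 0 * ppEr 2 + ppEr 1 ^ 2 = 0 := by
  ext N
  rw [map_add, sq, coeff_mul, coeff_mul, ← Finset.sum_add_distrib, map_zero, ← sumW N, ← pp_sum N]
  refine Finset.sum_congr rfl fun p _ => ?_
  simp only [ppEr, coeff_mk, ppW]
  split_ifs <;> first | omega | simp

open PowerSeries in
lemma ppE_split : ppE = ppEr 0 + ppEr 1 + ppEr 2 := by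
  ext N
  simp only [ppEr, coeff_mk, map_add]
  by_cases h : N ∈ Set.range pentagonal
  · obtain ⟨m, rfl⟩ := h
    rcases pent_mod m with h | h | h | h | h <;> simp [h.2]
  · have : coeff N ppE = 0 := coeff_pentagonalSeries_eq_zero _ h
    simp [this]

open PowerSeries in
def ppSupp (r : ZMod 5) (f : PowerSeries (ZMod 5)) : Prop :=
  ∀ n : ℕ, (n : ZMod 5) ≠ r → coeff n f = 0

open PowerSeries in
lemma ppSupp.mul {r s : ZMod 5} {f g : PowerSeries (ZMod 5)} (hf : ppSupp r f) (hg : ppSupp s g) :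
    ppSupp (r + s) (f * g) := by
  intro n hn
  rw [coeff_mul]
  refine Finset.sum_eq_zero fun p hp => ?_
  rw [Finset.HasAntidiagonal.mem_antidiagonal] at hp
  by_cases h1 : (p.1 : ZMod 5) = r
  · by_cases h2 : (p.2 : ZMod 5) = s
    · exact absurd (by rw [← hp, ← h1, ← h2]; push_cast; rfl) hn
    · rw [hg _ h2, mul_zero]
  · rw [hf _ h1, zero_mul]

lemma ppSupp.add {r : ZMod 5} {f g : PowerSeries (ZMod 5)} (hf : ppSupp r f) (hg : ppSupp r g) :
    ppSupp r (f + g) := by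
  intro n hn
  rw [map_add, hf n hn, hg n hn, add_zero]

lemma ppSupp_Er (r : ℕ) : ppSupp (r : ZMod 5) (ppEr r) := by
  intro n hn
  simp only [ppEr, PowerSeries.coeff_mk]
  rw [if_neg]
  rintro h
  apply hn
  rw [← h]; simp

open PowerSeries in
lemma ppSupp_pow5 (f : PowerSeries (ZMod 5)) : ppSupp 0 (f ^ 5) := by
  intro n hn
  cases n with
  | zero => simp at hn
  | succ n =>
    have h := coeff_derivative (f ^ 5) n
    have h5 : ((5 : ℕ) : PowerSeries (ZMod 5)) = 0 := by
      have := congrArg (C (R := ZMod 5)) (show ((5 : ℕ) : ZMod 5) = 0 from by decide)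
      rwa [map_natCast, map_zero] at this
    rw [derivative_pow, h5, zero_mul, zero_mul, map_zero] at h
    have : Fact (Nat.Prime 5) := ⟨by norm_num⟩
    rcases mul_eq_zero.1 h.symm with h | h
    · exact h
    · exact absurd (by push_cast; exact h) hn

open PowerSeries in
lemma ppE_cube : ∃ A B : PowerSeries (ZMod 5), ppSupp 0 A ∧ ppSupp 1 B ∧ ppE ^ 3 = A + B := by
  have s0 : ppSupp 0 (ppEr 0) := by simpa using ppSupp_Er 0
  have s1 : ppSupp 1 (ppEr 1) := by simpa using ppSupp_Er 1
  have s2 : ppSupp 2 (ppEr 2) := by simpa using ppSupp_Er 2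
  have h5 : (5 : PowerSeries (ZMod 5)) = 0 := by
    have := congrArg (C (R := ZMod 5)) (show ((5 : ℕ) : ZMod 5) = 0 from by decide)
    rw [map_natCast, map_zero] at this
    exact_mod_cast this
  have a := (s0.mul s0).mul s0
  have b := (s1.mul s2).mul s2
  have c := (s0.mul s0).mul s1
  have d := (s2.mul s2).mul s2
  rw [show (0 + 0 + 0 : ZMod 5) = 0 by decide] at a
  rw [show (1 + 2 + 2 : ZMod 5) = 0 by decide] at b
  rw [show (0 + 0 + 1 : ZMod 5) = 1 by decide] at c
  rw [show (2 + 2 + 2 : ZMod 5) = 1 by decide] at d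
  refine ⟨_, _, ((a.add b).add b).add b, ((d.add c).add c).add c, ?_⟩
  rw [ppE_split]
  linear_combination (3 * ppEr 0 + 3 * ppEr 2 + ppEr 1) * ppE_rel
    + (ppEr 0 * ppEr 1 * ppEr 2) * h5

lemma partitionCount_eq (n : ℕ) : partitionCount n = Fintype.card (Nat.Partition n) := by
  rw [partitionCount, ← Nat.card_eq_fintype_card]
  refine Nat.card_congr ⟨fun l => ⟨l.1, fun {i} hi => l.2.1.2 i (by simpa using hi),
    by simpa using l.2.2⟩, fun p => ⟨p.parts.sort (· ≥ ·), ⟨Multiset.pairwise_sort _ _, ?_⟩, ?_⟩,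
    ?_, ?_⟩
  · intro x hx; exact p.parts_pos (by simpa using hx)
  · rw [← Multiset.sum_coe, Multiset.sort_eq, p.parts_sum]
  · rintro ⟨l, h⟩
    apply Subtype.ext
    dsimp only
    refine List.Perm.eq_of_pairwise (le := (· ≥ ·)) ?_ (Multiset.pairwise_sort _ _) h.1.1 ?_
    · intro a b _ _ h1 h2; exact le_antisymm h2 h1
    · rw [← Multiset.coe_eq_coe, Multiset.sort_eq]
  · intro p
    apply Nat.Partition.ext
    simp

noncomputable def ppP : PowerSeries (ZMod 5) :=
  PowerSeries.mk fun n => (partitionCount n : ZMod 5)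

open PowerSeries PowerSeries.WithPiTopology in
lemma ppP_mul : ppP * ppE = 1 := by
  have : Fact (Nat.Prime 5) := ⟨by norm_num⟩
  let : TopologicalSpace (ZMod 5) := ⊥
  have : DiscreteTopology (ZMod 5) := ⟨rfl⟩
  have h1 := Nat.Partition.hasProd_powerSeriesMk_card_restricted (ZMod 5) (fun _ => True)
  have h2 := hasProd_one_sub_X_pow (ZMod 5)
  have h3 := h1.mul h2
  have e : (PowerSeries.mk fun n =>
      ((Nat.Partition.restricted n (fun _ => True)).card : ZMod 5)) = ppP := by
    ext n
    simp [ppP, partitionCount_eq, Nat.Partition.restricted]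
  rw [e] at h3
  refine h3.unique ?_
  convert! hasProd_one using 1
  ext1 i
  simp only [if_true, pow_mul]
  exact tsum_pow_mul_one_sub_of_constantCoeff_eq_zero (by simp)

open PowerSeries in
lemma coeff_ppP_sq (n : ℕ) : coeff n (ppP ^ 2) = (pp n : ZMod 5) := by
  rw [sq, coeff_mul, Finset.Nat.sum_antidiagonal_eq_sum_range_succ_mk, pp]
  simp [ppP]

theorem pp_cong_zero (n : ℕ) (h : n % 5 = 2 ∨ n % 5 = 3 ∨ n % 5 = 4) :
    (5 : ℕ) ∣ pp n := by
  rw [← ZMod.natCast_eq_zero_iff, ← coeff_ppP_sq]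
  obtain ⟨A, B, hA, hB, hE⟩ := ppE_cube
  have e : ppP ^ 2 = A * ppP ^ 5 + B * ppP ^ 5 := by
    rw [← add_mul, ← hE]
    calc ppP ^ 2 = ppP ^ 2 * (ppP * ppE) ^ 3 := by rw [ppP_mul]; ring
      _ = _ := by ring
  have hn : (n : ZMod 5) = ((n % 5 : ℕ) : ZMod 5) := by simp
  rw [e, map_add, (hA.mul (ppSupp_pow5 ppP)) n, (hB.mul (ppSupp_pow5 ppP)) n, add_zero]
  · rw [hn]; rcases h with h | h | h <;> rw [h] <;> decide
  · rw [hn]; rcases h with h | h | h <;> rw [h] <;> decide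
end
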